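/- arXiv:2409.17962 — 2 statements merged into one kernel-verified Lean document; each statement's English description precedes it below -/
import Mathlib

section
/- Let μ ∈ ℝ, p > 1, s > 0 and t < μ. Let a > 0 be the unique positive solution of (μ − t)·a^p + ((μ − t)^p − s^p)·a − (μ − t)·s^p = 0. Then the infimum over P ∈ P(μ,s^p) of P([t, ∞)) equals (μ − t)/(a + μ − t). -/
open MeasureTheory

/-- Membership in the ambiguity set `P(μ,s^p)` defined by the `p`th power deviation. -/
def memAmbPow (μ p s : ℝ) (P : Measure ℝ) : Prop :=
  IsProbabilityMeasure P ∧ Integrable (fun x : ℝ => x) P ∧ (∫ x, x ∂P) = μ ∧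
  Integrable (fun x : ℝ => |x - μ| ^ p) P ∧ (∫ x, |x - μ| ^ p ∂P) = s ^ p

lemma aux_tangent (p a y : ℝ) (hp : 1 < p) (ha : 0 < a) :
    0 ≤ |y| ^ p - a ^ p - p * a ^ (p - 1) * (y - a) := by
  have h1 : 1 + p * (|y| / a - 1) ≤ (1 + (|y| / a - 1)) ^ p :=
    one_add_mul_self_le_rpow_one_add (by have : 0 ≤ |y| / a := by positivity
                                         linarith) hp.le
  have h2 : (1 + (|y| / a - 1)) ^ p = |y| ^ p / a ^ p := by
    rw [add_sub_cancel, Real.div_rpow (abs_nonneg y) ha.le]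
  rw [h2, le_div_iff₀ (by positivity)] at h1
  have h3 : a ^ p = a ^ (p - 1) * a := by
    rw [← Real.rpow_add_one ha.ne']; congr 1; ring
  have h4 : (1 + p * (|y| / a - 1)) * a ^ p = a ^ p + p * a ^ (p - 1) * (|y| - a) := by
    rw [h3]; field_simp
  rw [h4] at h1
  have h5 : p * a ^ (p - 1) * (y - a) ≤ p * a ^ (p - 1) * (|y| - a) := by
    have := le_abs_self y
    gcongr
  linarith

lemma aux_lower (μ p s t : ℝ) (hp : 1 < p) (ht : t < μ)
    (a : ℝ) (ha : 0 < a)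
    (heq : (μ - t) * a ^ p + ((μ - t) ^ p - s ^ p) * a - (μ - t) * s ^ p = 0)
    (P : Measure ℝ) (hP : memAmbPow μ p s P) :
    (μ - t) / (a + μ - t) ≤ (P (Set.Ici t)).toReal := by
  obtain ⟨hpr, hi1, he1, hi2, he2⟩ := hP
  have hd : 0 < μ - t := sub_pos.2 ht
  have h3 : a ^ p = a ^ (p - 1) * a := by
    rw [← Real.rpow_add_one ha.ne']; congr 1; ring
  set d := μ - t with hdd
  set c := a ^ (p - 1) with hc
  have hcpos : 0 < c := by positivity
  have hdp : 0 < d ^ p := by positivity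
  set H := d ^ p - a ^ p - p * c * (-d - a) with hH
  have hHpos : 0 < H := by
    have e : H = d ^ p + (p - 1) * (c * a) + p * c * d := by rw [hH, h3]; ring
    have : 0 < p - 1 := by linarith
    rw [e]; positivity
  have hint : Integrable (fun x : ℝ => |x - μ| ^ p - a ^ p - p * c * ((x - μ) - a)) P :=
    (hi2.sub (integrable_const _)).sub
      (((hi1.sub (integrable_const _)).sub (integrable_const _)).const_mul _)
  have hval : ∫ x, (|x - μ| ^ p - a ^ p - p * c * ((x - μ) - a)) ∂P
      = s ^ p - a ^ p - p * c * (0 - a) := by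
    have j1 : Integrable (fun x : ℝ => |x - μ| ^ p - a ^ p) P := hi2.sub (integrable_const _)
    have j2 : Integrable (fun x : ℝ => x - μ) P := hi1.sub (integrable_const _)
    have j3 : Integrable (fun x : ℝ => x - μ - a) P := j2.sub (integrable_const _)
    have j4 : Integrable (fun x : ℝ => p * c * (x - μ - a)) P := j3.const_mul _
    rw [integral_sub j1 j4, integral_sub hi2 (integrable_const _), integral_const_mul,
      integral_sub j2 (integrable_const _), integral_sub hi1 (integrable_const _), he1, he2]
    simp
  have hle : ∫ x, (Set.Iio t).indicator (fun _ => H) x ∂P ≤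
      ∫ x, (|x - μ| ^ p - a ^ p - p * c * ((x - μ) - a)) ∂P := by
    apply integral_mono ((integrable_const _).indicator measurableSet_Iio) hint
    intro x
    by_cases hx : x ∈ Set.Iio t
    · simp only [Set.indicator_of_mem hx]
      have hx' : x < t := hx
      have hab : d ≤ |x - μ| := by
        rw [abs_of_neg (by linarith)]; linarith
      have h1 : d ^ p ≤ |x - μ| ^ p := Real.rpow_le_rpow hd.le hab (by linarith)
      have h2 : p * c * ((x - μ) - a) ≤ p * c * (-d - a) := by
        have : (x - μ) ≤ -d := by linarith
        gcongr
      linarith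
    · simp only [Set.indicator_of_notMem hx]
      exact aux_tangent p a (x - μ) hp ha
  rw [hval, integral_indicator_const _ measurableSet_Iio, smul_eq_mul] at hle
  have hcompl : P.real (Set.Iio t) = 1 - P.real (Set.Ici t) := by
    rw [← Set.compl_Ici]; exact probReal_compl_eq_one_sub measurableSet_Ici
  rw [hcompl] at hle
  change _ ≤ P.real (Set.Ici t)
  have e1 : a + μ - t = a + d := by rw [hdd]; ring
  rw [e1]
  have key : (s ^ p - a ^ p - p * c * (0 - a)) * (a + d) = a * H := by
    rw [hH]; rw [h3] at heq ⊢; linear_combination -heq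
  have h6 : (1 - P.real (Set.Ici t)) * (a + d) ≤ a := by
    have : (1 - P.real (Set.Ici t)) * H * (a + d) ≤ a * H := by
      rw [← key]; gcongr
    have h7 : ((1 - P.real (Set.Ici t)) * (a + d)) * H ≤ a * H := by linarith
    exact le_of_mul_le_mul_right h7 hHpos
  rw [div_le_iff₀ (by positivity)]
  linarith

lemma aux_exists (μ p s t : ℝ) (hp : 1 < p) (hs : 0 < s) (ht : t < μ)
    (a : ℝ) (ha : 0 < a)
    (heq : (μ - t) * a ^ p + ((μ - t) ^ p - s ^ p) * a - (μ - t) * s ^ p = 0)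
    (r : ℝ) (hr : 0 < r) (hra : r < a / (μ - t)) :
    ∃ P : Measure ℝ, memAmbPow μ p s P ∧ 1 / (1 + r) = (P (Set.Ici t)).toReal := by
  have hd : 0 < μ - t := sub_pos.2 ht
  set d := μ - t with hdd
  set K := (r + r ^ p) / (1 + r) with hK
  have hKpos : 0 < K := by positivity
  set e := s / K ^ (1 / p) with he
  have hepos : 0 < e := by positivity
  have hep : e ^ p * K = s ^ p := by
    rw [he, Real.div_rpow hs.le (by positivity), ← Real.rpow_mul hKpos.le,
      one_div_mul_cancel (by linarith), Real.rpow_one]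
    field_simp
  have hdK : d ^ p * K < s ^ p := by
    set R := a / d with hR
    have hRpos : 0 < R := by positivity
    have hRp : R ^ p = a ^ p / d ^ p := Real.div_rpow ha.le hd.le p
    have hdp : 0 < d ^ p := by positivity
    have e1 : d ^ p * ((R + R ^ p) / (1 + R)) = s ^ p := by
      rw [hRp, hR]
      field_simp
      linear_combination heq
    rw [← e1]
    apply mul_lt_mul_of_pos_left _ hdp
    have hf : ∀ x : ℝ, 0 < x → (x + x ^ p) / (1 + x) = x / (1 + x) * (1 + x ^ (p - 1)) := by
      intro x hx
      have : x ^ p = x ^ (p - 1) * x := by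
        rw [← Real.rpow_add_one hx.ne']; congr 1; ring
      rw [this]; field_simp
    rw [hK, hf r hr, hf R hRpos]
    have g1 : r / (1 + r) < R / (1 + R) := by
      rw [div_lt_div_iff₀ (by positivity) (by positivity)]; nlinarith
    have g2 : r ^ (p - 1) < R ^ (p - 1) := Real.rpow_lt_rpow hr.le hra (by linarith)
    have g3 : 0 < r ^ (p - 1) := by positivity
    apply mul_lt_mul'' g1 (by linarith) (by positivity) (by positivity)
  have hde : d < e := by
    rw [← hep] at hdK
    have := lt_of_mul_lt_mul_right hdK hKpos.le
    exact (Real.rpow_lt_rpow_iff hd.le hepos.le (by linarith)).1 this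
  have hq0 : 0 ≤ 1 / (1 + r) := by positivity
  have hq1 : 0 ≤ r / (1 + r) := by positivity
  let P : Measure ℝ := ENNReal.ofReal (r / (1 + r)) • Measure.dirac (μ - e) +
    ENNReal.ofReal (1 / (1 + r)) • Measure.dirac (μ + r * e)
  have hsum : ENNReal.ofReal (r / (1 + r)) + ENNReal.ofReal (1 / (1 + r)) = 1 := by
    rw [← ENNReal.ofReal_add hq1 hq0]
    have : r / (1 + r) + 1 / (1 + r) = 1 := by field_simp; ring
    rw [this, ENNReal.ofReal_one]
  have hI : ∀ f : ℝ → ℝ, Integrable f P := by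
    intro f
    exact ((integrable_dirac (by simp)).smul_measure ENNReal.ofReal_ne_top).add_measure
      ((integrable_dirac (by simp)).smul_measure ENNReal.ofReal_ne_top)
  have hV : ∀ f : ℝ → ℝ, ∫ x, f x ∂P = r / (1 + r) * f (μ - e) + 1 / (1 + r) * f (μ + r * e) := by
    intro f
    rw [integral_add_measure ((integrable_dirac (by simp)).smul_measure ENNReal.ofReal_ne_top)
      ((integrable_dirac (by simp)).smul_measure ENNReal.ofReal_ne_top),
      integral_smul_measure, integral_smul_measure, integral_dirac, integral_dirac,
      ENNReal.toReal_ofReal hq1, ENNReal.toReal_ofReal hq0, smul_eq_mul, smul_eq_mul]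
  refine ⟨P, ⟨⟨?_⟩, hI _, ?_, hI _, ?_⟩, ?_⟩
  · simpa [P] using hsum
  · rw [hV]; field_simp; ring
  · rw [hV]
    have a1 : |μ - e - μ| = e := by
      rw [show μ - e - μ = -e by ring, abs_neg, abs_of_pos hepos]
    have a2 : |μ + r * e - μ| = r * e := by
      rw [show μ + r * e - μ = r * e by ring, abs_of_pos (by positivity)]
    rw [a1, a2, Real.mul_rpow hr.le hepos.le, ← hep, hK]
    field_simp
  · have m1 : (μ - e) ∉ Set.Ici t := by
      simp only [Set.mem_Ici, not_le]; linarith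
    have m2 : (μ + r * e) ∈ Set.Ici t := by
      have : 0 < r * e := by positivity
      simp only [Set.mem_Ici]; linarith
    have : P (Set.Ici t) = ENNReal.ofReal (1 / (1 + r)) := by
      simp only [P, Measure.add_apply, Measure.smul_apply, Measure.dirac_apply' _ measurableSet_Ici,
        Set.indicator_of_notMem m1, Set.indicator_of_mem m2]
      simp
    rw [this, ENNReal.toReal_ofReal hq0]

/-- Tight lower bound on the tail probability `P([t,∞))` over the
`p`th power deviation ambiguity set, for `t < μ`. -/
theorem stmt12 (μ p s t : ℝ) (hp : 1 < p) (hs : 0 < s) (ht : t < μ)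
    (a : ℝ) (ha : 0 < a)
    (heq : (μ - t) * a ^ p + ((μ - t) ^ p - s ^ p) * a - (μ - t) * s ^ p = 0)
    (huniq : ∀ b : ℝ, 0 < b →
      (μ - t) * b ^ p + ((μ - t) ^ p - s ^ p) * b - (μ - t) * s ^ p = 0 → b = a) :
    sInf {y : ℝ | ∃ P : Measure ℝ, memAmbPow μ p s P ∧ y = (P (Set.Ici t)).toReal} =
      (μ - t) / (a + μ - t) := by
  have hd : 0 < μ - t := sub_pos.2 ht
  have hR : 0 < a / (μ - t) := by positivity
  apply csInf_eq_of_forall_ge_of_forall_gt_exists_lt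
  · obtain ⟨P, hP, h⟩ := aux_exists μ p s t hp hs ht a ha heq (a / (μ - t) / 2)
      (by positivity) (by linarith)
    exact ⟨_, P, hP, h⟩
  · rintro y ⟨P, hP, rfl⟩
    exact aux_lower μ p s t hp ht a ha heq P hP
  · intro w hw
    have hq : (μ - t) / (a + μ - t) = 1 / (1 + a / (μ - t)) := by
      have : a + μ - t = (μ - t) + a := by ring
      rw [this]; field_simp
    rw [hq] at hw
    have hw0 : 0 < w := lt_trans (by positivity) hw
    have h1 : 1 / w - 1 < a / (μ - t) := by
      rw [div_lt_comm₀ (by positivity) hw0] at hw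
      linarith
    obtain ⟨r, hr1, hr2⟩ := exists_between (max_lt h1 hR)
    have hr0 : 0 < r := lt_of_le_of_lt (le_max_right _ _) hr1
    have hrw : 1 / w - 1 < r := lt_of_le_of_lt (le_max_left _ _) hr1
    obtain ⟨P, hP, h⟩ := aux_exists μ p s t hp hs ht a ha heq r hr0 hr2
    refine ⟨_, ⟨P, hP, h⟩, ?_⟩
    rw [div_lt_comm₀ (by positivity) hw0]
    linarith
end

section
/- Let μ ∈ ℝ, σ > 0 and t ∈ ℝ, and set Δ = √((t − μ)² + σ²). Then the maximum over P ∈ P(μ,σ²) of E_P[max{X − t, 0}] equals ((μ − t) + Δ)/2, and it is attained by the two-point distribution supported on v1 = t − Δ and v2 = t + Δ with masses w1 = (v2 − μ)/(v2 − v1) and w2 = (μ − v1)/(v2 − v1) (Scarf's bound). -/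
open MeasureTheory

/-- The two-point distribution with data `(v1, w1, v2, w2)`. -/
noncomputable def twoPoint (v1 w1 v2 w2 : ℝ) : Measure ℝ :=
  (ENNReal.ofReal w1) • Measure.dirac v1 + (ENNReal.ofReal w2) • Measure.dirac v2

/-- Membership in the mean-variance ambiguity set `P(μ,σ²)` (second argument is `σ²`). -/
def memMV (μ σ2 : ℝ) (P : Measure ℝ) : Prop :=
  IsProbabilityMeasure P ∧ Integrable (fun x : ℝ => x) P ∧ (∫ x, x ∂P) = μ ∧
  Integrable (fun x : ℝ => (x - μ) ^ 2) P ∧ (∫ x, (x - μ) ^ 2 ∂P) = σ2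

theorem twoPoint_int (v1 w1 v2 w2 : ℝ) (f : ℝ → ℝ) : Integrable f (twoPoint v1 w1 v2 w2) := by
  unfold twoPoint
  refine Integrable.add_measure ?_ ?_
  · exact (integrable_dirac (by simp)).smul_measure (by simp)
  · exact (integrable_dirac (by simp)).smul_measure (by simp)

theorem twoPoint_integral (v1 w1 v2 w2 : ℝ) (h1 : 0 ≤ w1) (h2 : 0 ≤ w2) (f : ℝ → ℝ) :
    ∫ x, f x ∂(twoPoint v1 w1 v2 w2) = w1 * f v1 + w2 * f v2 := by
  unfold twoPoint
  rw [integral_add_measure]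
  · simp [integral_smul_measure, h1, h2]
  · exact (integrable_dirac (by simp)).smul_measure (by simp)
  · exact (integrable_dirac (by simp)).smul_measure (by simp)

theorem scarf_upper (μ σ t Δ : ℝ) (hD : 0 < Δ) (hs : Δ ^ 2 = (t - μ) ^ 2 + σ ^ 2)
    (P : Measure ℝ) (h : memMV μ (σ ^ 2) P) :
    ∫ x, max (x - t) 0 ∂P ≤ ((μ - t) + Δ) / 2 := by
  obtain ⟨hP, hi1, he1, hi2, he2⟩ := h
  have hi3 : Integrable (fun x : ℝ => (1 / (4 * Δ)) * (x - μ) ^ 2) P := hi2.const_mul _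
  have hi4 : Integrable (fun x : ℝ => (1 / 2 + (μ - t) / (2 * Δ)) * x) P := hi1.const_mul _
  have hi5 : Integrable (fun _ : ℝ => (- t / 2 + Δ / 4 + ((μ - t) ^ 2 - 2 * (μ - t) * μ) / (4 * Δ))) P :=
    integrable_const _
  have hi34 : Integrable (fun x : ℝ => (1 / (4 * Δ)) * (x - μ) ^ 2
    + (1 / 2 + (μ - t) / (2 * Δ)) * x) P := hi3.add hi4
  have hle : ∀ x : ℝ, max (x - t) 0 ≤ (1 / (4 * Δ)) * (x - μ) ^ 2
      + (1 / 2 + (μ - t) / (2 * Δ)) * x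
      + (- t / 2 + Δ / 4 + ((μ - t) ^ 2 - 2 * (μ - t) * μ) / (4 * Δ)) := by
    intro x
    have e : (1 / (4 * Δ)) * (x - μ) ^ 2
      + (1 / 2 + (μ - t) / (2 * Δ)) * x
      + (- t / 2 + Δ / 4 + ((μ - t) ^ 2 - 2 * (μ - t) * μ) / (4 * Δ))
      = (x - t + Δ) ^ 2 / (4 * Δ) := by
      field_simp
      ring
    rw [e]
    apply max_le
    · rw [le_div_iff₀ (by positivity)]
      nlinarith [sq_nonneg (x - t - Δ)]
    · positivity
  have hm : Integrable (fun x : ℝ => max (x - t) 0) P :=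
    (hi1.sub (integrable_const t)).pos_part
  refine (integral_mono hm (hi34.add hi5) hle).trans (le_of_eq ?_)
  have e1 := integral_add hi34 hi5
  have e2 := integral_add hi3 hi4
  simp only [Pi.add_apply]
  rw [e1, e2, integral_const_mul, integral_const_mul, he1, he2, integral_const]
  simp only [probReal_univ, one_smul]
  have : σ ^ 2 = Δ ^ 2 - (t - μ) ^ 2 := by linarith
  rw [this]
  field_simp
  ring

/-- Scarf's bound: the maximum of `E_P[max{X - t, 0}]` over `P(μ,σ²)`
equals `((μ - t) + Δ)/2` with `Δ = √((t - μ)² + σ²)`, attained at the two-point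
distribution supported on `t - Δ` and `t + Δ`. -/
theorem stmt16 (μ σ t Δ : ℝ) (hσ : 0 < σ) (hΔ : Δ = Real.sqrt ((t - μ) ^ 2 + σ ^ 2)) :
    sSup {y : ℝ | ∃ P : Measure ℝ, memMV μ (σ ^ 2) P ∧
        y = ∫ x, max (x - t) 0 ∂P} = ((μ - t) + Δ) / 2 ∧
    memMV μ (σ ^ 2)
      (twoPoint (t - Δ) (((t + Δ) - μ) / ((t + Δ) - (t - Δ)))
        (t + Δ) ((μ - (t - Δ)) / ((t + Δ) - (t - Δ)))) ∧
    (∫ x, max (x - t) 0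
        ∂(twoPoint (t - Δ) (((t + Δ) - μ) / ((t + Δ) - (t - Δ)))
          (t + Δ) ((μ - (t - Δ)) / ((t + Δ) - (t - Δ))))) = ((μ - t) + Δ) / 2 := by
  have hs : Δ ^ 2 = (t - μ) ^ 2 + σ ^ 2 := by
    rw [hΔ, Real.sq_sqrt (by positivity)]
  have hD : 0 < Δ := by rw [hΔ]; positivity
  clear hΔ
  have ha : |t - μ| ≤ Δ := abs_le_of_sq_le_sq (by nlinarith) hD.le
  have ha1 := (abs_le.1 ha).1
  have ha2 := (abs_le.1 ha).2
  have hd : (t + Δ) - (t - Δ) = 2 * Δ := by ring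
  rw [hd]
  have h1 : 0 ≤ ((t + Δ) - μ) / (2 * Δ) := div_nonneg (by linarith) (by linarith)
  have h2 : 0 ≤ (μ - (t - Δ)) / (2 * Δ) := div_nonneg (by linarith) (by linarith)
  have hmem : memMV μ (σ ^ 2) (twoPoint (t - Δ) (((t + Δ) - μ) / (2 * Δ))
        (t + Δ) ((μ - (t - Δ)) / (2 * Δ))) := by
    refine ⟨⟨?_⟩, twoPoint_int _ _ _ _ _, ?_, twoPoint_int _ _ _ _ _, ?_⟩
    · simp only [twoPoint, Measure.add_apply, Measure.smul_apply, measure_univ, smul_eq_mul, mul_one]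
      rw [← ENNReal.ofReal_add h1 h2, ← ENNReal.ofReal_one]
      congr 1
      field_simp
      ring
    · rw [twoPoint_integral _ _ _ _ h1 h2 (fun x => x)]
      field_simp
      ring
    · rw [twoPoint_integral _ _ _ _ h1 h2 (fun x => (x - μ) ^ 2)]
      have : σ ^ 2 = Δ ^ 2 - (t - μ) ^ 2 := by linarith
      rw [this]
      field_simp
      ring
  have hint : (∫ x, max (x - t) 0 ∂(twoPoint (t - Δ) (((t + Δ) - μ) / (2 * Δ))
        (t + Δ) ((μ - (t - Δ)) / (2 * Δ)))) = ((μ - t) + Δ) / 2 := by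
    rw [twoPoint_integral _ _ _ _ h1 h2 (fun x => max (x - t) 0)]
    rw [max_eq_right (by linarith : t - Δ - t ≤ 0), max_eq_left (by linarith : 0 ≤ t + Δ - t)]
    field_simp
    ring
  refine ⟨?_, hmem, hint⟩
  apply IsGreatest.csSup_eq
  refine ⟨⟨_, hmem, hint.symm⟩, ?_⟩
  rintro y ⟨P, hP, rfl⟩
  exact scarf_upper μ σ t Δ hD hs P hP
end
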